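/- If X is a uniformly locally path-connected uniform space with basepoint x₀, then the projection π : (X,x₀)^([0,1],0) → X̃ (with the uniform convergence structure on the path space) generates a uniform structure on X̃, and this structure equals the James uniform structure: E* = π(uc(E)) for every entourage E, and for every entourage E there is an entourage F with π(uc(F)) ∘ π(uc(F)) ⊆ π(uc(E)). -/

import Mathlib

open Set
open scoped Uniformity unitInterval

/-- Two paths starting at `x₀` are `E`-close in the James sense (`π(uc(E))`): some
path-homotopic (rel endpoints) representatives are pointwise `E`-close. -/
def JClose {X : Type*} [UniformSpace X] (x₀ : X) (E : Set (X × X))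
    (γ δ : {γ : C(I, X) // γ 0 = x₀}) : Prop :=
  ∃ γ' δ' : {γ : C(I, X) // γ 0 = x₀},
    γ'.1.HomotopicRel γ.1 {0, 1} ∧ δ'.1.HomotopicRel δ.1 {0, 1} ∧
    ∀ t : I, (γ'.1 t, δ'.1 t) ∈ E

open Path.Homotopic in
theorem Path.Homotopic.trans_conj_of_homotopic {X : Type*} [TopologicalSpace X] {x a b : X}
    (p : Path x a) (c : Path a b) {q r : Path x b} (h : q.Homotopic r) :
    (p.trans (c.trans (q.symm.trans (r.trans c.symm)))).Homotopic p := by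
  rw [← Quotient.eq] at h ⊢
  simp only [Quotient.mk_trans, Quotient.mk_symm, ← h]
  rw [← Quotient.trans_assoc (Quotient.symm _)]
  simp

open Path.Homotopic in
theorem Path.Homotopic.trans_refl_symm_trans_trans_refl {X : Type*} [TopologicalSpace X]
    {x b d : X} (q : Path x b) (s : Path x d) :
    (q.trans ((Path.refl b).trans (q.symm.trans (s.trans (Path.refl d))))).Homotopic s := by
  rw [← Quotient.eq]
  simp only [Quotient.mk_trans, Quotient.mk_symm, Quotient.mk_refl, Quotient.refl_trans,
    Quotient.trans_refl]
  rw [← Quotient.trans_assoc]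
  simp

/-- A binary relation holding pointwise between the pieces of two concatenations holds pointwise
between the concatenations. -/
theorem Path.trans_mem_of_forall_mem {X : Type*} [TopologicalSpace X] {E : Set (X × X)}
    {a b c a' b' c' : X} {p : Path a b} {q : Path b c} {p' : Path a' b'} {q' : Path b' c'}
    (hp : ∀ t, (p t, p' t) ∈ E) (hq : ∀ t, (q t, q' t) ∈ E) (t : I) :
    (p.trans q t, p'.trans q' t) ∈ E := by
  rw [Path.trans_apply, Path.trans_apply]
  split_ifs
  exacts [hp _, hq _]

/-- If `X` is uniformly locally path-connected, then the projection
`π : (X,x₀)^([0,1],0) → X̃` generates a uniform structure on `X̃`, equal to the James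
uniform structure: `E* = π(uc(E))` (built into `JClose`), and for every entourage `E`
there is an entourage `F` with `π(uc(F)) ∘ π(uc(F)) ⊆ π(uc(E))`. -/
theorem stmt_19 {X : Type*} [UniformSpace X] (x₀ : X)
    (hulpc : ∀ E ∈ 𝓤 X, ∃ F ∈ 𝓤 X, ∀ p ∈ F,
      ∃ γ : Path (Prod.fst p) (Prod.snd p), ∃ z : X, ∀ t, (z, γ t) ∈ E) :
    ∀ E ∈ 𝓤 X, ∃ F ∈ 𝓤 X, ∀ γ δ ε : {γ : C(I, X) // γ 0 = x₀},
      JClose x₀ F γ δ → JClose x₀ F δ ε → JClose x₀ E γ ε := by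
  intro E hE
  obtain ⟨W, hW, hsymm, hWE⟩ := comp_comp_symm_mem_uniformity_sets hE
  obtain ⟨F, hF, hFW⟩ := hulpc W hW
  refine ⟨F ∩ W, Filter.inter_mem hF hW, ?_⟩
  rintro γ δ ε ⟨γ', δ', hγ, hδ, hγδ⟩ ⟨δ'', ε', hδ', hε, hδε⟩
  have hδδ : δ'.1.HomotopicRel δ''.1 {0, 1} := hδ.trans hδ'.symm
  have hend : δ''.1 1 = δ'.1 1 := (hδδ.fst_eq_snd (by simp)).symm
  have comp₃ {a b c d : X} (hab : (a, b) ∈ W) (hbc : (b, c) ∈ W) (hcd : (c, d) ∈ W) :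
      (a, d) ∈ E := hWE ⟨c, ⟨b, hab, hbc⟩, hcd⟩
  have hrefl (a : X) : (a, a) ∈ W := refl_mem_uniformity hW
  have hWsymm {a b : X} (h : (a, b) ∈ W) : (b, a) ∈ W := SetRel.symm W h
  obtain ⟨c, z, hc⟩ := hFW _ (hγδ 1).1
  dsimp only at c hc
  have hcz (t : I) : (c t, z) ∈ W := hWsymm (hc t)
  have hzb : (z, δ'.1 1) ∈ W := by simpa using hc 1
  let p : Path x₀ (γ'.1 1) := ⟨γ'.1, γ'.2, rfl⟩
  let q : Path x₀ (δ'.1 1) := ⟨δ'.1, δ'.2, rfl⟩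
  let r : Path x₀ (δ'.1 1) := ⟨δ''.1, δ''.2, hend⟩
  let s : Path x₀ (ε'.1 1) := ⟨ε'.1, ε'.2, rfl⟩
  have hqr : q.Homotopic r := hδδ
  let g := p.trans (c.trans (q.symm.trans (r.trans c.symm)))
  let e := q.trans ((Path.refl _).trans (q.symm.trans (s.trans (Path.refl _))))
  have hg : g.Homotopic p := Path.Homotopic.trans_conj_of_homotopic p c hqr
  have he : e.Homotopic s := Path.Homotopic.trans_refl_symm_trans_trans_refl q s
  refine ⟨⟨g.toContinuousMap, g.source⟩, ⟨e.toContinuousMap, e.source⟩,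
    ContinuousMap.HomotopicRel.trans hg hγ, ContinuousMap.HomotopicRel.trans he hε, ?_⟩
  refine Path.trans_mem_of_forall_mem (fun t ↦ ?_) <|
    Path.trans_mem_of_forall_mem (fun t ↦ ?_) <|
    Path.trans_mem_of_forall_mem (fun t ↦ ?_) <|
    Path.trans_mem_of_forall_mem (fun t ↦ ?_) (fun t ↦ ?_)
  · exact comp₃ (hγδ t).2 (hrefl _) (hrefl _)
  · exact comp₃ (hcz t) hzb (hrefl _)
  · exact refl_mem_uniformity hE
  · exact comp₃ (hδε t).2 (hrefl _) (hrefl _)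
  · exact comp₃ (hcz _) hzb (hend ▸ (hδε 1).2)
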